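/- arXiv:1702.04173 — 9 statements merged into one kernel-verified Lean document; each statement's English description precedes it below -/
import Mathlib

section
/- Let m ≥ 1, n ≥ 1, and let V = Fin m carry its natural linear order with minimum element 0. Every function f : (Fin n → V) → V belongs to the clone on V generated by the binary operations min and max together with all unary selection operators s_a^j for a, j ∈ V. (Equivalently: a canonically suitable m-valued logic containing all unary selection operators is functionally complete.) -/
/-- The unary selection operator `s_a^j` on `Fin m`: maps `a` to `j` and
everything else to the minimum element `0`. -/
def sel (m : ℕ) [NeZero m] (a j : Fin m) (x : Fin m) : Fin m :=
  if x = a then j else 0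

/-- The clone on `Fin m` generated by the binary operations `min` and `max`
together with all unary selection operators: the smallest family of finitary
operations containing all projections and closed under pointwise `min`,
pointwise `max`, and postcomposition with each selection operator. -/
inductive SelClone (m : ℕ) [NeZero m] : (n : ℕ) → ((Fin n → Fin m) → Fin m) → Prop
  | proj (n : ℕ) (k : Fin n) : SelClone m n (fun x => x k)
  | min' (n : ℕ) (f g : (Fin n → Fin m) → Fin m) :
      SelClone m n f → SelClone m n g → SelClone m n (fun x => min (f x) (g x))
  | max' (n : ℕ) (f g : (Fin n → Fin m) → Fin m) :
      SelClone m n f → SelClone m n g → SelClone m n (fun x => max (f x) (g x))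
  | sel' (n : ℕ) (a j : Fin m) (f : (Fin n → Fin m) → Fin m) :
      SelClone m n f → SelClone m n (fun x => sel m a j (f x))

theorem SelClone.inf' {m n : ℕ} [NeZero m] {ι : Type*} {s : Finset ι} (hs : s.Nonempty)
    {F : ι → (Fin n → Fin m) → Fin m} (hF : ∀ i ∈ s, SelClone m n (F i)) :
    SelClone m n (s.inf' hs F) :=
  Finset.inf'_induction hs F (fun f hf g hg => SelClone.min' n f g hf hg) hF

theorem SelClone.sup' {m n : ℕ} [NeZero m] {ι : Type*} {s : Finset ι} (hs : s.Nonempty)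
    {F : ι → (Fin n → Fin m) → Fin m} (hF : ∀ i ∈ s, SelClone m n (F i)) :
    SelClone m n (s.sup' hs F) :=
  Finset.sup'_induction hs F (fun f hf g hg => SelClone.max' n f g hf hg) hF

/-- The infimum of selections at the coordinates of `a` takes the value `j` at `a` and
`0` elsewhere. -/
theorem inf'_sel_apply {m n : ℕ} [NeZero m] (hn : (Finset.univ : Finset (Fin n)).Nonempty)
    (a x : Fin n → Fin m) (j : Fin m) :
    Finset.univ.inf' hn (fun k (y : Fin n → Fin m) => sel m (a k) j (y k)) x =
      if x = a then j else 0 := by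
  rw [Finset.inf'_apply]
  split_ifs with h
  · subst h
    simp [sel]
  · obtain ⟨k, hk⟩ := Function.ne_iff.mp h
    refine le_antisymm ((Finset.inf'_le _ (Finset.mem_univ k)).trans ?_) (Fin.zero_le _)
    simp [sel, hk]

/-- A canonically suitable `m`-valued logic containing all unary selection
operators is functionally complete: every `n`-ary operation on `Fin m` lies in
the clone generated by `min`, `max` and the unary selection operators. -/
theorem stmt0 (m n : ℕ) [NeZero m] (hn : 1 ≤ n) (f : (Fin n → Fin m) → Fin m) :
    SelClone m n f := by
  have : NeZero n := ⟨by omega⟩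
  have h_univ : (Finset.univ : Finset (Fin n)).Nonempty := Finset.univ_nonempty
  have h_clone : SelClone m n (Finset.univ.sup' Finset.univ_nonempty fun a : Fin n → Fin m =>
      Finset.univ.inf' h_univ fun k y => sel m (a k) (f a) (y k)) :=
    SelClone.sup' _ fun a _ => SelClone.inf' _ fun k _ =>
      SelClone.sel' n (a k) (f a) _ (SelClone.proj n k)
  convert h_clone using 1
  funext x
  rw [Finset.sup'_apply]
  simp only [inf'_sel_apply]
  apply le_antisymm
  · exact Finset.le_sup'_of_le _ (Finset.mem_univ x) (by simp)
  · refine Finset.sup'_le _ _ fun a _ => ?_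
    split_ifs with h
    · rw [h]
    · exact Fin.zero_le _
end

section
/- Suppose f : 𝟜 → 𝟜 is expressible in normal form over Belnap logic, i.e., there are r ≥ 0 clauses, the i-th clause being a nonempty finite list of unary functions u_{i,1}, …, u_{i,s_i} each equal to the identity or to Belnap negation ¬ (the compositions of the only unary operator ¬ of Belnap logic), such that for all x ∈ 𝟜, f(x) = ⊕_{i=1}^{r} ⊗_{j=1}^{s_i} u_{i,j}(x) (the empty join being ⊥). Then f(⊥) = ⊥. Consequently, for every d ≠ ⊥ the unary selection operator s_⊥^d is not expressible in normal form, and hence Belnap logic (and in particular PBel) is not canonically complete. -/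
/-- The Belnap set `𝟜` realized as `Bool × Bool` with the product order
(the knowledge order `≤ₖ`): `⊥ = (false, false)`, `0 = (true, false)`,
`1 = (false, true)`, `⊤ = (true, true)`.  The lattice meet `⊓` is the
knowledge meet `⊗` and the lattice join `⊔` is the knowledge join `⊕`. -/
abbrev B4 := Bool × Bool

def botB : B4 := (false, false)

/-- Belnap negation `¬`: fixes `⊥` and `⊤`, swaps `0` and `1`. -/
def negB (p : B4) : B4 := (p.2, p.1)

/-- The unary selection operator `s_a^j` on `𝟜`. -/
def selB (a j : B4) (x : B4) : B4 := if x = a then j else botB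

/-- Evaluation of a nonempty clause (a head literal together with a list of
further literals, each literal a unary function applied to the variable):
the knowledge meet `⊗` of the values of the literals. -/
def evalClause1 (x : B4) (c : (B4 → B4) × List (B4 → B4)) : B4 :=
  c.2.foldr (fun u acc => u x ⊓ acc) (c.1 x)

/-- `f : 𝟜 → 𝟜` is expressible in normal form over Belnap logic: there is a
list of clauses, each a nonempty list of unary functions that are each the
identity or Belnap negation (the compositions of `¬`), such that `f` is the
knowledge join `⊕` over the clauses of the knowledge meet `⊗` over the
literals in the clause (the empty join being `⊥`). -/
def NFExpressible (f : B4 → B4) : Prop :=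
  ∃ clauses : List ((B4 → B4) × List (B4 → B4)),
    (∀ c ∈ clauses, ∀ u ∈ c.1 :: c.2, u = id ∨ u = negB) ∧
    ∀ x : B4, f x = clauses.foldr (fun c acc => evalClause1 x c ⊔ acc) botB

theorem evalClause1_botB {c : (B4 → B4) × List (B4 → B4)}
    (h : ∀ u ∈ c.1 :: c.2, u botB = botB) : evalClause1 botB c = botB := by
  obtain ⟨v, l⟩ := c
  unfold evalClause1
  induction l with
  | nil => exact h v (by simp)
  | cons u l ih =>
    have hl := ih fun w hw => h w (by simp at hw ⊢; tauto)
    have hu := h u (by simp)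
    simp only [List.foldr_cons] at hl ⊢
    rw [hl, hu, inf_idem]

theorem NFExpressible.apply_botB {f : B4 → B4} (hf : NFExpressible f) : f botB = botB := by
  obtain ⟨cs, hcs, hf⟩ := hf
  rw [hf]
  clear hf
  induction cs with
  | nil => rfl
  | cons c cs ih =>
    have hc : evalClause1 botB c = botB := evalClause1_botB fun u hu => by
      rcases hcs c (by simp) u hu with rfl | rfl <;> rfl
    rw [List.foldr_cons, ih fun d hd => hcs d (List.mem_cons_of_mem c hd), hc, sup_idem]

/-- Any `f : 𝟜 → 𝟜` expressible in normal form over Belnap logic satisfies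
`f ⊥ = ⊥`; consequently for every `d ≠ ⊥` the unary selection operator
`s_⊥^d` is not expressible in normal form, so Belnap logic (in particular
PBel) is not canonically complete. -/
theorem stmt1 :
    (∀ f : B4 → B4, NFExpressible f → f botB = botB) ∧
    (∀ d : B4, d ≠ botB → ¬ NFExpressible (selB botB d)) := by
  refine ⟨fun f hf => hf.apply_botB, fun d hd hf => hd ?_⟩
  simpa [selB] using hf.apply_botB
end

section
/- Let T be the clone on 𝟜 generated by the conflation − and the knowledge meet ⊗, i.e., the smallest family of finitary operations on 𝟜 containing all projections and closed under postcomposition with − and under pointwise ⊗. Then every n-ary operation f ∈ T satisfies f(0, 0, …, 0) = 0. In particular, Belnap negation ¬ (which maps 0 to 1) is not in T, so {−, ⊗} is not functionally complete. -/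
def zeroB : B4 := (true, false)

/-- The conflation operator `−`: fixes `0` and `1`, swaps `⊥` and `⊤`. -/
def conf (p : B4) : B4 := (!p.2, !p.1)

/-- The clone `T` on `𝟜` generated by conflation `−` and the knowledge meet
`⊗`: the smallest family of finitary operations on `𝟜` containing all
projections and closed under postcomposition with `−` and under pointwise `⊗`. -/
inductive ConfClone : (n : ℕ) → ((Fin n → B4) → B4) → Prop
  | proj (n : ℕ) (k : Fin n) : ConfClone n (fun x => x k)
  | conf' (n : ℕ) (f : (Fin n → B4) → B4) :
      ConfClone n f → ConfClone n (fun x => conf (f x))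
  | meet' (n : ℕ) (f g : (Fin n → B4) → B4) :
      ConfClone n f → ConfClone n g → ConfClone n (fun x => f x ⊓ g x)

theorem ConfClone.apply_zeroB {n : ℕ} {f : (Fin n → B4) → B4} (hf : ConfClone n f) :
    f (fun _ => zeroB) = zeroB := by
  induction hf with
  | proj => rfl
  | conf' _ _ ih => simp only [ih]; rfl
  | meet' _ _ _ _ ihf ihg => simp only [ihf, ihg, inf_idem]

/-- Every `n`-ary operation in the clone generated by `{−, ⊗}` maps the
constant tuple `(0, …, 0)` to `0`.  In particular Belnap negation `¬` (which
maps `0` to `1`) is not in this clone, so `{−, ⊗}` is not functionally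
complete. -/
theorem stmt3 :
    (∀ (n : ℕ) (f : (Fin n → B4) → B4), ConfClone n f → f (fun _ => zeroB) = zeroB) ∧
    ¬ ConfClone 1 (fun x => negB (x 0)) := by
  refine ⟨fun _ _ hf => hf.apply_zeroB, fun h => ?_⟩
  exact absurd h.apply_zeroB (by decide)
end

section
/- Let n ≥ 2 and let a, b ∈ Fin n with a < b. The subgroup of Equiv.Perm (Fin n) generated by the transposition Equiv.swap a b together with the n-cycle c given by c(i) = i + 1 (mod n) is the whole symmetric group if and only if gcd(b − a, n) = 1 (where b − a is computed as the difference of the underlying natural numbers). -/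
theorem finRotate_val_modEq {n d : ℕ} (hd : d ∣ n) (x : Fin n) :
    (finRotate n x : ℕ) ≡ x + 1 [MOD d] := by
  have := x.neZero
  rw [finRotate_apply, Fin.val_add, Fin.val_one']
  exact ((Nat.mod_modEq _ n).trans (Nat.ModEq.add_left _ (Nat.mod_modEq 1 n))).of_dvd hd

theorem swap_val_modEq {n d : ℕ} {a b : Fin n} (h : (a : ℕ) ≡ b [MOD d]) (x : Fin n) :
    (Equiv.swap a b x : ℕ) ≡ x [MOD d] := by
  rcases eq_or_ne x a with rfl | hxa
  · simpa using h.symm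
  · rcases eq_or_ne x b with rfl | hxb
    · simpa using h
    · rw [Equiv.swap_apply_of_ne_of_ne hxa hxb]

theorem val_modEq_iff_of_mem_closure_swap_finRotate {n d : ℕ} {a b : Fin n} (hd : d ∣ n)
    (h : (a : ℕ) ≡ b [MOD d]) {σ : Equiv.Perm (Fin n)}
    (hσ : σ ∈ Subgroup.closure ({Equiv.swap a b, finRotate n} : Set (Equiv.Perm (Fin n))))
    (x y : Fin n) : (σ x : ℕ) ≡ σ y [MOD d] ↔ (x : ℕ) ≡ y [MOD d] := by
  induction hσ using Subgroup.closure_induction generalizing x y with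
  | mem σ hσ =>
    rcases hσ with rfl | rfl
    · have hx := swap_val_modEq h x
      have hy := swap_val_modEq h y
      exact ⟨fun e => hx.symm.trans (e.trans hy), fun e => hx.trans (e.trans hy.symm)⟩
    · have hx := finRotate_val_modEq hd x
      have hy := finRotate_val_modEq hd y
      exact ⟨fun e => Nat.ModEq.add_right_cancel' 1 (hx.symm.trans (e.trans hy)),
        fun e => hx.trans ((e.add_right 1).trans hy.symm)⟩
  | one => rfl
  | mul σ τ _ _ hσ hτ => exact (hσ _ _).trans (hτ x y)
  | inv σ _ hσ => simpa using (hσ (σ⁻¹ x) (σ⁻¹ y)).symm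

open Fin.NatCast in
theorem finRotate_pow_apply {n : ℕ} [NeZero n] (k : ℕ) (x : Fin n) :
    (finRotate n ^ k) x = x + (k : Fin n) := by
  induction k with
  | zero => simp
  | succ k ih => rw [pow_succ', Equiv.Perm.mul_apply, ih, finRotate_apply, Nat.cast_succ, add_assoc]

/-- For `n ≥ 2` and `a < b` in `Fin n`, the transposition `(a b)` together
with the `n`-cycle `i ↦ i + 1 (mod n)` (i.e. `finRotate n`) generate the whole
symmetric group `Equiv.Perm (Fin n)` if and only if `gcd (b − a) n = 1`,
where `b − a` is the difference of the underlying natural numbers. -/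
theorem stmt5 (n : ℕ) (hn : 2 ≤ n) (a b : Fin n) (hab : a < b) :
    Subgroup.closure ({Equiv.swap a b, finRotate n} : Set (Equiv.Perm (Fin n))) =
        (⊤ : Subgroup (Equiv.Perm (Fin n))) ↔
      Nat.gcd (b.val - a.val) n = 1 := by
  have hlt : a.val < b.val := hab
  have hb := b.isLt
  constructor
  · intro htop
    by_contra hne
    set d := Nat.gcd (b.val - a.val) n
    have hpos : 0 < d := Nat.gcd_pos_of_pos_right _ (by omega)
    have hle : d ≤ b.val - a.val := Nat.gcd_le_left _ (by omega)
    have hmod : (a : ℕ) ≡ b [MOD d] :=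
      (Nat.modEq_iff_dvd' hlt.le).mpr (Nat.gcd_dvd_left _ _)
    let x : Fin n := ⟨0, by omega⟩
    let y : Fin n := ⟨1, by omega⟩
    let z : Fin n := ⟨d, by omega⟩
    have hzx : z ≠ x := by simp only [z, x, ne_eq, Fin.mk.injEq]; omega
    have hzy : z ≠ y := by simp only [z, y, ne_eq, Fin.mk.injEq]; omega
    have key := (val_modEq_iff_of_mem_closure_swap_finRotate (Nat.gcd_dvd_right _ _) hmod
      (σ := Equiv.swap x y) (htop ▸ Subgroup.mem_top _) x z).mpr
      (Nat.mod_self d).symm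
    rw [Equiv.swap_apply_left, Equiv.swap_apply_of_ne_of_ne hzx hzy] at key
    have : 1 % d = d % d := key
    rw [Nat.mod_self, Nat.mod_eq_of_lt (by omega)] at this
    omega
  · intro hgcd
    have : NeZero n := ⟨by omega⟩
    have hpow : (finRotate n ^ (b.val - a.val)) a = b := by
      ext
      rw [finRotate_pow_apply, Fin.val_add, Fin.val_natCast, Nat.add_mod_mod,
        Nat.add_sub_cancel' hlt.le, Nat.mod_eq_of_lt hb]
    have h := Equiv.Perm.closure_cycle_coprime_swap (σ := finRotate n) (n := b.val - a.val)
      (by simpa using hgcd) (isCycle_finRotate_of_le hn) (support_finRotate_of_le hn) a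
    rwa [hpow, Set.pair_comm] at h
end

section
/- For all a, j ∈ 𝟜 there exist three permutations p, q, r of 𝟜 such that for every x ∈ 𝟜, the unary selection operator satisfies s_a^j(x) = p(x) ⊗ q(x) ⊗ r(x), where ⊗ is the knowledge meet. That is, every unary selection operator on 𝟜 is the pointwise knowledge-meet of three permutations of 𝟜. -/
theorem selB_top (j x : B4) :
    selB ⊤ j x = Equiv.swap j ⊤ x ⊓ Equiv.swap botB (true, false) x ⊓
      Equiv.swap botB (false, true) x := by
  revert j x
  decide

theorem selB_eq_selB_top (a j x : B4) : selB a j x = selB ⊤ j (Equiv.swap a ⊤ x) := by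
  simp [selB, Equiv.swap_apply_eq_iff]

/-- Every unary selection operator on `𝟜` is the pointwise knowledge-meet of
three permutations of `𝟜`: for all `a, j ∈ 𝟜` there are permutations
`p, q, r` with `s_a^j(x) = p(x) ⊗ q(x) ⊗ r(x)` for every `x`. -/
theorem stmt7 (a j : B4) :
    ∃ p q r : Equiv.Perm B4, ∀ x : B4, selB a j x = p x ⊓ q x ⊓ r x := by
  refine ⟨Equiv.swap j ⊤ * Equiv.swap a ⊤, Equiv.swap botB (true, false) * Equiv.swap a ⊤,
    Equiv.swap botB (false, true) * Equiv.swap a ⊤, fun x => ?_⟩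
  simp only [Equiv.Perm.mul_apply, selB_eq_selB_top a, selB_top]
end

section
/- For every function φ : 𝟜 → 𝟜 there exist finitely many clauses, each clause being a nonempty finite list of permutations of 𝟜, such that for all x ∈ 𝟜, φ(x) equals the knowledge-join (⊕) over the clauses of the knowledge-meet (⊗) over the permutations π in that clause of π(x) (the empty join being ⊥). In particular, every unary function on 𝟜 is expressible in the logic with operators {∼0, ∼1, ∼⊤, ⊗, ⊕}. -/
/-- Evaluation at `x` of a nonempty clause (a head permutation together with
a list of further permutations): the knowledge meet `⊗` over the permutations
`π` in the clause of `π(x)`. -/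
def evalClause8 (x : B4) (c : Equiv.Perm B4 × List (Equiv.Perm B4)) : B4 :=
  c.2.foldr (fun π acc => π x ⊓ acc) (c.1 x)

/-- A permutation fixing `⊤` and cyclically permuting `⊥`, `0` and `1`. -/
def cycleBelowTop : Equiv.Perm B4 :=
  Equiv.swap (false, false) (true, false) * Equiv.swap (true, false) (false, true)

/-- A clause whose value is `v` at `a` and `⊥` elsewhere. -/
def pointClause (a v : B4) : Equiv.Perm B4 × List (Equiv.Perm B4) :=
  (Equiv.swap a v, [Equiv.swap a ⊤, cycleBelowTop * Equiv.swap a ⊤])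

theorem evalClause8_pointClause (a v x : B4) :
    evalClause8 x (pointClause a v) = if x = a then v else ⊥ := by
  revert a v x
  decide

/-- Every function `φ : 𝟜 → 𝟜` is a knowledge-join (`⊕`) over finitely many
clauses of knowledge-meets (`⊗`) of permutations of `𝟜` applied to the
argument (the empty join being `⊥`).  In particular, since every permutation
of `𝟜` is a composition of `∼0`, `∼1`, `∼⊤`, every unary function on `𝟜` is
expressible in the logic with operators `{∼0, ∼1, ∼⊤, ⊗, ⊕}`. -/
theorem stmt8 (φ : B4 → B4) :
    ∃ clauses : List (Equiv.Perm B4 × List (Equiv.Perm B4)),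
      ∀ x : B4, φ x = clauses.foldr (fun c acc => evalClause8 x c ⊔ acc) botB := by
  refine ⟨[(false, false), (true, false), (false, true), (true, true)].map
    fun a => pointClause a (φ a), ?_⟩
  have h : botB = ⊥ := rfl
  rintro ⟨_ | _, _ | _⟩ <;> simp [evalClause8_pointClause, h]
end

section
/- For every n ≥ 1, every function f : (Fin n → 𝟜) → 𝟜 belongs to the clone on 𝟜 generated by the three transposition operators ∼0, ∼1, ∼⊤ and the binary knowledge meet ⊗, i.e., the smallest family of finitary operations on 𝟜 containing all projections and closed under postcomposition with ∼0, ∼1, ∼⊤ and under pointwise ⊗. Hence L(𝟜ₖ, {∼0, ∼1, ∼⊤, ⊗}) is functionally complete. -/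
def oneB : B4 := (false, true)
def topB : B4 := (true, true)

/-- The transposition operator `∼0 = (⊥ 0)`. -/
def tr0 (x : B4) : B4 := if x = botB then zeroB else if x = zeroB then botB else x

/-- The transposition operator `∼1 = (⊥ 1)`. -/
def tr1 (x : B4) : B4 := if x = botB then oneB else if x = oneB then botB else x

/-- The transposition operator `∼⊤ = (⊥ ⊤)` (conflation). -/
def trT (x : B4) : B4 := if x = botB then topB else if x = topB then botB else x

/-- The clone on `𝟜` generated by `∼0`, `∼1`, `∼⊤` and the knowledge meet `⊗`:
the smallest family of finitary operations on `𝟜` containing all projections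
and closed under postcomposition with `∼0`, `∼1`, `∼⊤` and under pointwise
`⊗`. -/
inductive TrClone : (n : ℕ) → ((Fin n → B4) → B4) → Prop
  | proj (n : ℕ) (k : Fin n) : TrClone n (fun x => x k)
  | tr0' (n : ℕ) (f : (Fin n → B4) → B4) : TrClone n f → TrClone n (fun x => tr0 (f x))
  | tr1' (n : ℕ) (f : (Fin n → B4) → B4) : TrClone n f → TrClone n (fun x => tr1 (f x))
  | trT' (n : ℕ) (f : (Fin n → B4) → B4) : TrClone n f → TrClone n (fun x => trT (f x))
  | meet' (n : ℕ) (f g : (Fin n → B4) → B4) :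
      TrClone n f → TrClone n g → TrClone n (fun x => f x ⊓ g x)

namespace TrClone

variable {n : ℕ} {f g : (Fin n → B4) → B4}

theorem swap (hf : TrClone n f) : TrClone n (fun x => (f x).swap) := by
  convert hf.tr0'.tr1'.tr0' using 2 with x
  generalize f x = y
  revert y
  decide

theorem compl (hf : TrClone n f) : TrClone n (fun x => (f x)ᶜ) := by
  convert hf.swap.trT' using 2 with x
  generalize f x = y
  revert y
  decide

theorem sup (hf : TrClone n f) (hg : TrClone n g) : TrClone n (fun x => f x ⊔ g x) := by
  simpa only [compl_inf, compl_compl] using (hf.compl.meet' _ _ _ hg.compl).compl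

theorem indicator_top (hf : TrClone n f) :
    TrClone n (fun x => if f x = topB then topB else botB) := by
  convert hf.meet' _ _ _ hf.swap using 2 with x
  generalize f x = y
  revert y
  decide

theorem indicator (hf : TrClone n f) (a : B4) :
    TrClone n (fun x => if f x = a then topB else botB) := by
  have key : ∃ g, TrClone n g ∧ ∀ x, g x = topB ↔ f x = a := by
    obtain rfl | rfl | rfl | rfl : a = topB ∨ a = botB ∨ a = zeroB ∨ a = oneB := by
      revert a
      decide
    · exact ⟨_, hf, fun _ => Iff.rfl⟩
    · refine ⟨_, hf.trT', fun x => ?_⟩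
      generalize f x = y
      revert y
      decide
    · refine ⟨_, hf.tr0'.trT', fun x => ?_⟩
      generalize f x = y
      revert y
      decide
    · refine ⟨_, hf.tr1'.trT', fun x => ?_⟩
      generalize f x = y
      revert y
      decide
  obtain ⟨g, hg, h⟩ := key
  simpa only [h] using hg.indicator_top

theorem const (hn : 1 ≤ n) (c : B4) : TrClone n (fun _ => c) := by
  have hbot : TrClone n (fun _ => botB) := by
    have h := proj n ⟨0, hn⟩
    convert (h.indicator topB).meet' _ _ _ (h.indicator botB) using 2 with x
    generalize x ⟨0, hn⟩ = y
    revert y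
    decide
  obtain rfl | rfl | rfl | rfl : c = botB ∨ c = zeroB ∨ c = oneB ∨ c = topB := by
    revert c
    decide
  exacts [hbot, hbot.tr0', hbot.tr1', hbot.trT']

theorem single (hn : 1 ≤ n) (a : Fin n → B4) (c : B4) :
    TrClone n (fun x => if x = a then c else ⊥) := by
  have key (t : Finset (Fin n)) :
      TrClone n (fun x => if ∀ i ∈ t, x i = a i then c else ⊥) := by
    induction t using Finset.induction_on with
    | empty => simpa using const hn c
    | insert j t _ ih =>
      convert ((proj n j).indicator (a j)).meet' _ _ _ ih using 2 with x
      rw [show topB = ⊤ from rfl, show botB = ⊥ from rfl]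
      by_cases h : x j = a j <;> simp [h]
  simpa [funext_iff] using key Finset.univ

end TrClone

/-- For every `n ≥ 1`, every function `f : (Fin n → 𝟜) → 𝟜` lies in the clone
on `𝟜` generated by `∼0, ∼1, ∼⊤` and `⊗`; hence `L(𝟜ₖ, {∼0, ∼1, ∼⊤, ⊗})` is
functionally complete. -/
theorem stmt10 (n : ℕ) (hn : 1 ≤ n) (f : (Fin n → B4) → B4) : TrClone n f := by
  have key (s : Finset (Fin n → B4)) : TrClone n (fun x => if x ∈ s then f x else ⊥) := by
    induction s using Finset.induction_on with
    | empty => simpa using TrClone.const hn ⊥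
    | insert a s ha ih =>
      convert (TrClone.single hn a (f a)).sup ih using 2 with x
      by_cases h : x = a
      · subst h
        simp [ha]
      · simp [h]
  simpa using key Finset.univ
end

section
/- Let ◇ : 𝟜 → 𝟜 be the 4-cycle ⊥ ↦ 0 ↦ 1 ↦ ⊤ ↦ ⊥ and let − be conflation (the transposition (⊥ ⊤)). For every n ≥ 1, every function f : (Fin n → 𝟜) → 𝟜 belongs to the clone on 𝟜 generated by −, ◇, and the binary knowledge meet ⊗, i.e., the smallest family of finitary operations on 𝟜 containing all projections and closed under postcomposition with − and ◇ and under pointwise ⊗. Hence L(𝟜ₖ, {−, ◇, ⊗}) is functionally and canonically complete. -/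
/-- The 4-cycle `◇ : ⊥ ↦ 0 ↦ 1 ↦ ⊤ ↦ ⊥`. -/
def cyc (x : B4) : B4 :=
  if x = botB then zeroB else if x = zeroB then oneB
  else if x = oneB then topB else botB

/-- The clone on `𝟜` generated by `−`, `◇` and the knowledge meet `⊗`:
the smallest family of finitary operations on `𝟜` containing all projections
and closed under postcomposition with `−` and `◇` and under pointwise `⊗`. -/
inductive CDClone : (n : ℕ) → ((Fin n → B4) → B4) → Prop
  | proj (n : ℕ) (k : Fin n) : CDClone n (fun x => x k)
  | conf' (n : ℕ) (f : (Fin n → B4) → B4) : CDClone n f → CDClone n (fun x => conf (f x))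
  | cyc' (n : ℕ) (f : (Fin n → B4) → B4) : CDClone n f → CDClone n (fun x => cyc (f x))
  | meet' (n : ℕ) (f g : (Fin n → B4) → B4) :
      CDClone n f → CDClone n g → CDClone n (fun x => f x ⊓ g x)

namespace CDClone

variable {n : ℕ} {f g : (Fin n → B4) → B4}

theorem iterate_cyc (hf : CDClone n f) (k : ℕ) : CDClone n (fun x => cyc^[k] (f x)) := by
  induction k with
  | zero => exact hf
  | succ k ih => simpa only [Function.iterate_succ_apply'] using cyc' n _ ih

theorem swap (hf : CDClone n f) : CDClone n (fun x => (f x).swap) := by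
  have swap_eq : ∀ p : B4, p.swap = cyc (cyc (conf (cyc (cyc p)))) := by decide
  simpa only [swap_eq] using cyc' n _ (cyc' n _ (conf' n _ (cyc' n _ (cyc' n _ hf))))

theorem compl (hf : CDClone n f) : CDClone n (fun x => (f x)ᶜ) := by
  have compl_eq : ∀ p : B4, pᶜ = conf p.swap := by decide
  simpa only [compl_eq] using conf' n _ hf.swap

theorem sup (hf : CDClone n f) (hg : CDClone n g) : CDClone n (fun x => f x ⊔ g x) := by
  simpa only [compl_inf, compl_compl] using (meet' n _ _ hf.compl hg.compl).compl

theorem const (hn : 1 ≤ n) (c : B4) : CDClone n (fun _ => c) := by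
  have hp := proj n ⟨0, hn⟩
  have bot_eq : ∀ p : B4, ⊥ = p ⊓ pᶜ := by decide
  have hbot : CDClone n (fun _ => (⊥ : B4)) := by
    convert meet' n _ _ hp hp.compl using 2
    exact bot_eq _
  have exists_iterate : ∀ c : B4, ∃ k : Fin 4, cyc^[k] ⊥ = c := by decide
  obtain ⟨k, rfl⟩ := exists_iterate c
  exact hbot.iterate_cyc k

theorem finset_inf {ι : Type*} (hn : 1 ≤ n) (s : Finset ι) {F : ι → (Fin n → B4) → B4}
    (hF : ∀ i, CDClone n (F i)) : CDClone n (fun x => s.inf fun i => F i x) := by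
  classical
  induction s using Finset.induction_on with
  | empty => exact const hn ⊤
  | insert i s _ ih => simpa only [Finset.inf_insert] using meet' n _ _ (hF i) ih

theorem finset_sup {ι : Type*} (hn : 1 ≤ n) (s : Finset ι) {F : ι → (Fin n → B4) → B4}
    (hF : ∀ i, CDClone n (F i)) : CDClone n (fun x => s.sup fun i => F i x) := by
  classical
  induction s using Finset.induction_on with
  | empty => exact const hn ⊥
  | insert i s _ ih => simpa only [Finset.sup_insert] using (hF i).sup ih

theorem indicator (hf : CDClone n f) (a : B4) :
    CDClone n (fun x => if f x = a then ⊤ else ⊥) := by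
  have exists_iterate : ∀ a : B4, ∃ k : Fin 4, ∀ p : B4,
      (if p = a then ⊤ else ⊥) = cyc^[k] p ⊓ (cyc^[k] p).swap := by decide
  obtain ⟨k, hk⟩ := exists_iterate a
  simpa only [hk] using meet' n _ _ (hf.iterate_cyc k) (hf.iterate_cyc k).swap

theorem indicator_point (hn : 1 ≤ n) (a : Fin n → B4) :
    CDClone n (fun x => if x = a then ⊤ else ⊥) := by
  convert finset_inf hn Finset.univ fun i => (proj n i).indicator (a i) using 2 with x
  split_ifs with h
  · simp [h]
  · obtain ⟨i, hi⟩ := Function.ne_iff.mp h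
    exact (le_bot_iff.mp ((Finset.inf_le (Finset.mem_univ i)).trans_eq (if_neg hi))).symm

end CDClone

/-- For every `n ≥ 1`, every function `f : (Fin n → 𝟜) → 𝟜` lies in the clone
on `𝟜` generated by `−`, `◇` and `⊗`; hence `L(𝟜ₖ, {−, ◇, ⊗})` is functionally
(and canonically) complete. -/
theorem stmt11 (n : ℕ) (hn : 1 ≤ n) (f : (Fin n → B4) → B4) : CDClone n f := by
  convert CDClone.finset_sup hn Finset.univ fun a =>
    CDClone.meet' n _ _ (CDClone.indicator_point hn a) (CDClone.const hn (f a)) using 2 with x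
  refine le_antisymm ?_ (Finset.sup_le fun a _ => ?_)
  · exact (by simp : f x ≤ (if x = x then ⊤ else ⊥) ⊓ f x).trans
      (Finset.le_sup (f := fun a => (if x = a then ⊤ else ⊥) ⊓ f a) (Finset.mem_univ x))
  · split_ifs with h <;> simp [h]
end

section
/- Let m ≥ 2 and n ≥ 1, with V = Fin m carrying its natural linear order (minimum 0). For every function f : (Fin n → V) → V there exist finitely many clauses, each clause being a nonempty finite list of pairs (π, k) with π a permutation of V and k ∈ Fin n, such that for every assignment x : Fin n → V, f(x) equals the maximum over the clauses of the minimum over the pairs (π, k) in that clause of π(x k) (the empty maximum being 0). Since every permutation of Fin m is a composition of the transposition † = (0, m−1) and the m-cycle ◇, this expresses every f in normal form over {†, ◇, min}, so the m-valued logic L(Fin m, {†, ◇, min}) is functionally and canonically complete. -/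
/-- Evaluation at an assignment `x : Fin n → Fin m` of a nonempty clause (a
head literal and a list of further literals, each literal a pair `(π, k)` of a
permutation of `Fin m` and a variable index): the minimum over the literals
`(π, k)` of `π (x k)`. -/
def evalClause15 {m n : ℕ} (x : Fin n → Fin m)
    (c : (Equiv.Perm (Fin m) × Fin n) × List (Equiv.Perm (Fin m) × Fin n)) : Fin m :=
  c.2.foldr (fun l acc => min (l.1 (x l.2)) acc) (c.1.1 (x c.1.2))

theorem le_evalClause15_iff {m n : ℕ} (x : Fin n → Fin m)
    (c : (Equiv.Perm (Fin m) × Fin n) × List (Equiv.Perm (Fin m) × Fin n)) (z : Fin m) :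
    z ≤ evalClause15 x c ↔ ∀ l ∈ c.1 :: c.2, z ≤ l.1 (x l.2) := by
  obtain ⟨h, t⟩ := c
  induction t with
  | nil => simp [evalClause15]
  | cons l t ih =>
    simp only [evalClause15, List.foldr_cons, le_min_iff, List.forall_mem_cons] at ih ⊢
    rw [ih]
    tauto

theorem foldr_max_le_iff {α β : Type*} [LinearOrder β] (g : α → β) (b z : β) (L : List α) :
    L.foldr (fun c acc => max (g c) acc) b ≤ z ↔ b ≤ z ∧ ∀ c ∈ L, g c ≤ z := by
  induction L with
  | nil => simp
  | cons c L ih =>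
    simp only [List.foldr_cons, max_le_iff, List.forall_mem_cons, ih]
    tauto

theorem exists_perm_apply_eq_and_apply_eq {α : Type*} [DecidableEq α] {a b v w : α}
    (hab : a ≠ b) (hvw : v ≠ w) : ∃ π : Equiv.Perm α, π a = v ∧ π b = w := by
  refine ⟨(Equiv.swap a v).trans (Equiv.swap (Equiv.swap a v b) w), ?_, by simp⟩
  have hb : v ≠ Equiv.swap a v b := fun h => hab <| by
    have := congrArg (Equiv.swap a v) h
    simpa using this
  simp [Equiv.swap_apply_of_ne_of_ne hb hvw]

/-- A clause can take a prescribed nonminimal value at one assignment and vanish at all others. -/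
theorem exists_evalClause15_eq {m n : ℕ} (k₀ : Fin n) (a : Fin n → Fin m) (v w : Fin m)
    (hwv : w < v) :
    ∃ c : (Equiv.Perm (Fin m) × Fin n) × List (Equiv.Perm (Fin m) × Fin n),
      evalClause15 a c = v ∧ ∀ x, x ≠ a → evalClause15 x c ≤ w := by
  classical
  refine ⟨((Equiv.swap (a k₀) v, k₀),
    (Finset.univ.filter fun l : Equiv.Perm (Fin m) × Fin n => l.1 (a l.2) = v).toList), ?_, ?_⟩
  · refine le_antisymm ?_ ?_
    · exact ((le_evalClause15_iff a _ _).1 le_rfl _ List.mem_cons_self).trans_eq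
        (Equiv.swap_apply_left _ _)
    · rw [le_evalClause15_iff]
      simp +contextual
  · intro x hx
    obtain ⟨k, hk⟩ := Function.ne_iff.1 hx
    obtain ⟨π, hπa, hπx⟩ := exists_perm_apply_eq_and_apply_eq hk.symm hwv.ne'
    rw [← hπx]
    exact (le_evalClause15_iff x _ _).1 le_rfl (π, k) (List.mem_cons_of_mem _ (by simp [hπa]))

/-- Let `m ≥ 2`, `n ≥ 1` and `V = Fin m` with its natural linear order
(minimum `0`).  Every `f : (Fin n → V) → V` is a maximum over finitely many
clauses of minimums of permutations of `V` applied to variables (the empty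
maximum being `0`).  Since every permutation of `Fin m` is a composition of
the transposition `† = (0, m−1)` and the `m`-cycle `◇`, this expresses every
`f` in normal form over `{†, ◇, min}`, so the `m`-valued logic
`L(Fin m, {†, ◇, min})` is functionally and canonically complete. -/
theorem stmt15 (m n : ℕ) (hm : 2 ≤ m) (hn : 1 ≤ n) (f : (Fin n → Fin m) → Fin m) :
    ∃ clauses :
        List ((Equiv.Perm (Fin m) × Fin n) × List (Equiv.Perm (Fin m) × Fin n)),
      ∀ x : Fin n → Fin m,
        f x = clauses.foldr (fun c acc => max (evalClause15 x c) acc)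
                ⟨0, by omega⟩ := by
  classical
  let z : Fin m := ⟨0, by omega⟩
  have hz : ∀ v : Fin m, z ≤ v := fun v => Nat.zero_le v
  have hc : ∀ a : Fin n → Fin m, z < f a → _ := fun a ha =>
    exists_evalClause15_eq (⟨0, hn⟩ : Fin n) a (f a) z ha
  choose c hca hcx using hc
  refine ⟨(Finset.univ : Finset {a // z < f a}).toList.map fun a => c a.1 a.2, fun x => ?_⟩
  refine le_antisymm ?_ ?_
  · rcases (hz (f x)).eq_or_lt with h | h
    · exact h ▸ hz _
    · rw [← hca x h]
      refine ((foldr_max_le_iff (evalClause15 x) _ _ _).1 le_rfl).2 _ ?_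
      exact List.mem_map.2 ⟨⟨x, h⟩, by simp, rfl⟩
  · refine (foldr_max_le_iff (evalClause15 x) _ _ _).2 ⟨hz _, fun d hd => ?_⟩
    obtain ⟨⟨a, ha⟩, -, rfl⟩ := List.mem_map.1 hd
    by_cases h : x = a
    · subst h
      exact (hca x ha).le
    · exact (hcx a ha x h).trans (hz _)
end
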